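/- Let R be a nontrivial ring, let n, m ∈ ℕ with n < m, and let 1 → N → G → Q → 1 be a group extension, i.e., a surjective group homomorphism p : G → Q with kernel N. If every subgroup of G of type FP_n(R) is of type FP_m(R), and N is of type FP_{m-1}(R), then every subgroup of Q of type FP_n(R) is of type FP_m(R). (This is the homological analogue, over R, of part (ii) of the extension inheritance lemma: if G is homologically (n,m)-coherent over R and N is of type FP_{m-1}(R), then Q is homologically (n,m)-coherent over R.) -/

import Mathlib

universe u v w

/-- The augmentation ring homomorphism `R[G] → R`, sending every group element to `1`. -/
noncomputable def augmentation (R : Type u) [Ring R] (G : Type v) [Group G] :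
    MonoidAlgebra R G →+* R :=
  MonoidAlgebra.liftNCRingHom (RingHom.id R) (1 : G →* R)
    (fun x y => by simp)

/-- `R` as a module over the group ring `R[G]`, with the trivial `G`-action. -/
noncomputable instance trivialGroupRingModule (R : Type u) [Ring R] (G : Type v) [Group G] :
    Module (MonoidAlgebra R G) R :=
  Module.compHom R (augmentation R G)

/-- A witness that a group `G` is of type `FP_n(R)`: an exact sequence
`P_n → P_{n-1} → ⋯ → P_1 → P_0 → R → 0` of left `R[G]`-modules (with `R` carrying the
trivial `G`-action) in which each `P_i`, `i ≤ n`, is a finitely generated projective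
`R[G]`-module.  The family of modules and differentials is indexed by all of `ℕ`, but
only the data in degrees `≤ n` is constrained; exactness is required at `R` (i.e. the
augmentation `ε` is surjective), at `P_0` (when `n ≥ 1`), and at `P_i` for
`1 ≤ i ≤ n - 1`. -/
structure FPWitness (R : Type u) [Ring R] (G : Type v) [Group G] (n : ℕ) where
  P : ℕ → Type w
  [addCommGroup : ∀ i, AddCommGroup (P i)]
  [module : ∀ i, Module (MonoidAlgebra R G) (P i)]
  d : ∀ i, P (i + 1) →ₗ[MonoidAlgebra R G] P i
  ε : P 0 →ₗ[MonoidAlgebra R G] R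
  finite : ∀ i ≤ n, Module.Finite (MonoidAlgebra R G) (P i)
  projective : ∀ i ≤ n, Module.Projective (MonoidAlgebra R G) (P i)
  surjective : Function.Surjective ε
  exact_zero : 0 < n → LinearMap.range (d 0) = LinearMap.ker ε
  exact : ∀ i, i + 2 ≤ n → LinearMap.range (d (i + 1)) = LinearMap.ker (d i)

/-- A group `G` is of type `FP_n(R)` if there exists an exact sequence
`P_n → ⋯ → P_0 → R → 0` of left `R[G]`-modules in which each `P_i` is a finitely
generated projective `R[G]`-module and `R` carries the trivial `G`-action. -/
def Group.IsTypeFP (R : Type u) [Ring R] (G : Type v) [Group G] (n : ℕ) : Prop :=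
  Nonempty (FPWitness.{u, v, max u v} R G n)

section HomAlg

/-- Submodules of `A^k` of type `FP_n`. -/
def FPsub (A : Type u) [Ring A] : ℕ → ∀ k : ℕ, Submodule A (Fin k → A) → Prop
  | 0, _, S => S.FG
  | n + 1, k, S => ∃ (l : ℕ) (f : (Fin l → A) →ₗ[A] (Fin k → A)),
      LinearMap.range f = S ∧ FPsub A n l (LinearMap.ker f)

/-- Modules of type `FP_n`. -/
def FPn (A : Type u) [Ring A] (n : ℕ) (M : Type w) [AddCommGroup M] [Module A M] : Prop :=
  match n with
  | 0 => Module.Finite A M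
  | n + 1 => ∃ (k : ℕ) (f : (Fin k → A) →ₗ[A] M),
      Function.Surjective f ∧ FPsub A n k (LinearMap.ker f)

theorem FPn_submodule {A : Type u} [Ring A] (n : ℕ) {k : ℕ} (S : Submodule A (Fin k → A)) :
    FPn A n S ↔ FPsub A n k S := by
  cases n with
  | zero => exact Module.Finite.iff_fg
  | succ n =>
    constructor
    · rintro ⟨l, f, hf, h⟩
      refine ⟨l, S.subtype ∘ₗ f, ?_, ?_⟩
      · rw [LinearMap.range_comp, LinearMap.range_eq_top.2 hf]; simp
      · rw [LinearMap.ker_comp_of_ker_eq_bot _ (Submodule.ker_subtype S)]; exact h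
    · rintro ⟨l, f, hf, h⟩
      subst hf
      refine ⟨l, f.rangeRestrict, f.surjective_rangeRestrict, ?_⟩
      rw [LinearMap.ker_rangeRestrict]; exact h

theorem FPn_zero {A : Type u} [Ring A] {M : Type w} [AddCommGroup M] [Module A M] :
    FPn A 0 M ↔ Module.Finite A M := Iff.rfl

theorem FPn_succ {A : Type u} [Ring A] {n : ℕ} {M : Type w} [AddCommGroup M] [Module A M] :
    FPn A (n + 1) M ↔ ∃ (k : ℕ) (f : (Fin k → A) →ₗ[A] M),
      Function.Surjective f ∧ FPn A n (LinearMap.ker f) := by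
  simp only [FPn_submodule]; rfl

theorem FPn_equiv {A : Type u} [Ring A] {n : ℕ} {M : Type w} [AddCommGroup M] [Module A M]
    {M' : Type v} [AddCommGroup M'] [Module A M'] (e : M ≃ₗ[A] M') (h : FPn A n M) :
    FPn A n M' := by
  cases n with
  | zero => have := FPn_zero.1 h; exact Module.Finite.equiv e
  | succ n =>
    obtain ⟨k, f, hf, h⟩ := h
    refine ⟨k, e.toLinearMap ∘ₗ f, e.surjective.comp hf, ?_⟩
    rw [LinearMap.ker_comp_of_ker_eq_bot _ e.ker]; exact h

theorem FPn_succ_of {A : Type u} [Ring A] {n k : ℕ} {M : Type w} [AddCommGroup M] [Module A M]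
    {P : Type v} [AddCommGroup P] [Module A P] (e : (Fin k → A) ≃ₗ[A] P) (f : P →ₗ[A] M)
    (hf : Function.Surjective f) (h : FPn A n (LinearMap.ker f)) : FPn A (n + 1) M := by
  refine FPn_succ.2 ⟨k, f ∘ₗ e.toLinearMap, hf.comp e.surjective, ?_⟩
  rw [LinearMap.ker_comp]
  exact FPn_equiv (e.ofSubmodule' (LinearMap.ker f)).symm h

theorem FPn_finite {A : Type u} [Ring A] {n : ℕ} {M : Type w} [AddCommGroup M] [Module A M]
    (h : FPn A n M) : Module.Finite A M := by
  cases n with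
  | zero => exact h
  | succ n =>
    obtain ⟨k, f, hf, h⟩ := h
    exact Module.Finite.of_surjective f hf

universe w₁ w₂ w₃

theorem ext_zero {A : Type u} [Ring A]
    {M' : Type w₁} {M : Type w₂} {M'' : Type w₃} [AddCommGroup M'] [AddCommGroup M]
    [AddCommGroup M''] [Module A M'] [Module A M] [Module A M'']
    (i : M' →ₗ[A] M) (q : M →ₗ[A] M'') (hq : Function.Surjective q)
    (hiq : LinearMap.range i = LinearMap.ker q) (h' : Module.Finite A M')
    (h'' : Module.Finite A M'') : Module.Finite A M := by
  refine ⟨Submodule.fg_of_fg_map_of_fg_inf_ker q ?_ ?_⟩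
  · rw [Submodule.map_top, LinearMap.range_eq_top.2 hq]; exact h''.1
  · rw [top_inf_eq, ← hiq, LinearMap.range_eq_map]; exact h'.1.map i

theorem ext_step {A : Type u} [Ring A] (n : ℕ)
    (ih : ∀ (M' M M'' : Type u) [AddCommGroup M'] [AddCommGroup M]
      [AddCommGroup M''] [Module A M'] [Module A M] [Module A M'']
      (i : M' →ₗ[A] M) (q : M →ₗ[A] M''), Function.Injective i → Function.Surjective q →
      LinearMap.range i = LinearMap.ker q → FPn A n M' → FPn A n M'' → FPn A n M)
    {M' : Type w₁} {M : Type w₂} {M'' : Type w₃} [AddCommGroup M'] [AddCommGroup M]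
    [AddCommGroup M''] [Module A M'] [Module A M] [Module A M'']
    (i : M' →ₗ[A] M) (q : M →ₗ[A] M'') (hi : Function.Injective i) (hq : Function.Surjective q)
    (hiq : LinearMap.range i = LinearMap.ker q) (h' : FPn A (n + 1) M')
    (h'' : FPn A (n + 1) M'') : FPn A (n + 1) M := by
  obtain ⟨k, f', hf', hk'⟩ := FPn_succ.1 h'
  obtain ⟨l, f'', hf'', hk''⟩ := FPn_succ.1 h''
  obtain ⟨g, hg⟩ := Module.projective_lifting_property q f'' hq
  have hg' : ∀ x, q (g x) = f'' x := fun x => LinearMap.congr_fun hg x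
  have hqi : ∀ x, q (i x) = 0 := fun x => by
    have : i x ∈ LinearMap.ker q := hiq ▸ LinearMap.mem_range_self i x
    exact this
  let F : ((Fin k → A) × (Fin l → A)) →ₗ[A] M := (i ∘ₗ f').coprod g
  have hF : ∀ x, F x = i (f' x.1) + g x.2 := fun x => by simp [F]
  have hFs : Function.Surjective F := by
    intro m
    obtain ⟨y, hy⟩ := hf'' (q m)
    have : m - g y ∈ LinearMap.range i := by
      rw [hiq, LinearMap.mem_ker, map_sub, hg', hy, sub_self]
    obtain ⟨m', hm'⟩ := this
    obtain ⟨x, hx⟩ := hf' m'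
    exact ⟨(x, y), by rw [hF]; simp [hx, hm']⟩
  let e : (Fin (k + l) → A) ≃ₗ[A] ((Fin k → A) × (Fin l → A)) :=
    (LinearEquiv.funCongrLeft A A finSumFinEquiv).trans
      (LinearEquiv.sumArrowLequivProdArrow (Fin k) (Fin l) A A)
  refine FPn_succ_of e F hFs ?_
  let I : LinearMap.ker f' →ₗ[A] LinearMap.ker F :=
    ((LinearMap.inl A (Fin k → A) (Fin l → A)) ∘ₗ (LinearMap.ker f').subtype).codRestrict _
      (fun x => by
        have hx : f' x.1 = 0 := x.2
        rw [LinearMap.mem_ker, hF]; simp [hx])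
  let Qm : LinearMap.ker F →ₗ[A] LinearMap.ker f'' :=
    ((LinearMap.snd A (Fin k → A) (Fin l → A)) ∘ₗ (LinearMap.ker F).subtype).codRestrict _
      (fun x => by
        have hx : F x.1 = 0 := x.2
        rw [hF] at hx
        have := congrArg q hx
        rw [map_add, hqi, zero_add, hg', map_zero] at this
        exact this)
  have hI : ∀ x, (I x).1 = (x.1, 0) := fun x => rfl
  have hQ : ∀ x, (Qm x).1 = x.1.2 := fun x => rfl
  refine ih _ _ _ I Qm ?_ ?_ ?_ hk' hk''
  · intro x y hxy
    have := congrArg (fun z => z.1.1) hxy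
    exact Subtype.ext this
  · intro y
    have hy : f'' y.1 = 0 := y.2
    have : - g y.1 ∈ LinearMap.range i := by
      rw [hiq, LinearMap.mem_ker, map_neg, hg', hy, neg_zero]
    obtain ⟨m', hm'⟩ := this
    obtain ⟨x, hx⟩ := hf' m'
    exact ⟨⟨(x, y.1), by rw [LinearMap.mem_ker, hF]; simp [hx, hm']⟩, Subtype.ext rfl⟩
  · ext x
    constructor
    · rintro ⟨y, rfl⟩
      exact Subtype.ext rfl
    · intro hx
      have h2 : x.1.2 = 0 := congrArg Subtype.val (show Qm x = 0 from hx)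
      have h1 : F x.1 = 0 := x.2
      rw [hF, h2, map_zero, add_zero] at h1
      have h3 : f' x.1.1 = 0 := hi (by rw [h1, map_zero])
      exact ⟨⟨x.1.1, h3⟩, Subtype.ext (Prod.ext rfl h2.symm)⟩

theorem ext_base {A : Type u} [Ring A] (n : ℕ) :
    ∀ (M' M M'' : Type u) [AddCommGroup M'] [AddCommGroup M]
      [AddCommGroup M''] [Module A M'] [Module A M] [Module A M'']
      (i : M' →ₗ[A] M) (q : M →ₗ[A] M''), Function.Injective i → Function.Surjective q →
      LinearMap.range i = LinearMap.ker q → FPn A n M' → FPn A n M'' → FPn A n M := by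
  induction n with
  | zero => intro M' M M'' _ _ _ _ _ _ i q _ hq hiq h' h''; exact ext_zero i q hq hiq h' h''
  | succ n ih =>
    intro M' M M'' _ _ _ _ _ _ i q hi hq hiq h' h''; exact ext_step n ih i q hi hq hiq h' h''

section
variable {A : Type u} [Ring A] {n : ℕ}
    {M' : Type w₁} {M : Type w₂} {M'' : Type w₃} [AddCommGroup M'] [AddCommGroup M]
    [AddCommGroup M''] [Module A M'] [Module A M] [Module A M'']

theorem FPn_ext
    (i : M' →ₗ[A] M) (q : M →ₗ[A] M'') (hi : Function.Injective i) (hq : Function.Surjective q)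
    (hiq : LinearMap.range i = LinearMap.ker q) (h' : FPn A n M')
    (h'' : FPn A n M'') : FPn A n M := by
  cases n with
  | zero => exact ext_zero i q hq hiq h' h''
  | succ n => exact ext_step n (ext_base n) i q hi hq hiq h' h''


theorem FPn_quot_succ (q : M →ₗ[A] M'') (hq : Function.Surjective q)
    (h' : FPn A n (LinearMap.ker q)) (h : FPn A (n + 1) M) : FPn A (n + 1) M'' := by
  obtain ⟨k, f, hf, hk⟩ := FPn_succ.1 h
  refine FPn_succ.2 ⟨k, q ∘ₗ f, hq.comp hf, ?_⟩
  have hle : LinearMap.ker f ≤ LinearMap.ker (q ∘ₗ f) := LinearMap.ker_le_ker_comp f q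
  let Qm : LinearMap.ker (q ∘ₗ f) →ₗ[A] LinearMap.ker q :=
    (f ∘ₗ (LinearMap.ker (q ∘ₗ f)).subtype).codRestrict _ (fun x => x.2)
  refine FPn_ext (Submodule.inclusion hle) Qm (Submodule.inclusion_injective hle) ?_ ?_ hk h'
  · intro y
    obtain ⟨x, hx⟩ := hf y.1
    exact ⟨⟨x, by rw [LinearMap.mem_ker, LinearMap.comp_apply, hx]; exact y.2⟩, Subtype.ext hx⟩
  · ext x
    constructor
    · rintro ⟨y, rfl⟩
      exact Subtype.ext y.2
    · intro hx
      exact ⟨⟨x.1, congrArg Subtype.val (show Qm x = 0 from hx)⟩, rfl⟩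

theorem FPsub_of_succ {k : ℕ} {S : Submodule A (Fin k → A)} (h : FPsub A (n + 1) k S) :
    FPsub A n k S := by
  induction n generalizing k with
  | zero =>
    obtain ⟨l, f, rfl, -⟩ := h
    exact Module.Finite.iff_fg.1 inferInstance
  | succ n ih =>
    obtain ⟨l, f, hf, h⟩ := h
    exact ⟨l, f, hf, ih h⟩

theorem FPn_of_succ (h : FPn A (n + 1) M) : FPn A n M := by
  cases n with
  | zero => exact FPn_finite h
  | succ n =>
    obtain ⟨l, f, hf, h⟩ := h
    exact ⟨l, f, hf, FPsub_of_succ h⟩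

theorem FPn_mono {m : ℕ} (hnm : n ≤ m) (h : FPn A m M) : FPn A n M := by
  induction hnm with
  | refl => exact h
  | step _ ih => exact ih (FPn_of_succ h)

theorem FPn_quot (q : M →ₗ[A] M'') (hq : Function.Surjective q)
    (h' : FPn A n (LinearMap.ker q)) (h : FPn A n M) : FPn A n M'' := by
  cases n with
  | zero => have := FPn_finite h; exact Module.Finite.of_surjective q hq
  | succ n => exact FPn_quot_succ q hq (FPn_of_succ h') h

theorem FPsub_zero (S : Submodule A (Fin 0 → A)) : FPsub A n 0 S := by
  induction n with
  | zero => exact Module.Finite.iff_fg.1 inferInstance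
  | succ n ih =>
    exact ⟨0, 0, Subsingleton.elim _ _, by
      rw [Subsingleton.elim (LinearMap.ker _) S]; exact ih⟩

theorem FPn_subsingleton [Subsingleton M] : FPn A n M := by
  cases n with
  | zero => exact FPn_zero.2 inferInstance
  | succ n => exact ⟨0, 0, fun x => ⟨0, Subsingleton.elim _ _⟩, FPsub_zero _⟩

theorem FPn_free (k : ℕ) : FPn A n (Fin k → A) := by
  cases n with
  | zero => exact FPn_zero.2 inferInstance
  | succ n =>
    refine FPn_succ.2 ⟨k, LinearMap.id, Function.surjective_id, ?_⟩
    rw [LinearMap.ker_id]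
    exact FPn_subsingleton

theorem FPn_ker (q : M →ₗ[A] M'') (hq : Function.Surjective q)
    (h : FPn A n M) (h'' : FPn A (n + 1) M'') : FPn A n (LinearMap.ker q) := by
  obtain ⟨k, f, hf, hk⟩ := FPn_succ.1 h''
  obtain ⟨s, hs⟩ := Module.projective_lifting_property q f hq
  have hs' : ∀ x, q (s x) = f x := fun x => LinearMap.congr_fun hs x
  let D : ((Fin k → A) × M) →ₗ[A] M'' := f.coprod (-q)
  have hD : ∀ x, x ∈ LinearMap.ker D ↔ f x.1 = q x.2 := fun x => by
    rw [LinearMap.mem_ker]; simp [D, ← sub_eq_add_neg, sub_eq_zero]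
  -- the pullback is of type FP_n
  have hX : FPn A n (LinearMap.ker D) := by
    let I : LinearMap.ker f →ₗ[A] LinearMap.ker D :=
      ((LinearMap.inl A (Fin k → A) M) ∘ₗ (LinearMap.ker f).subtype).codRestrict _
        (fun x => by
          have hx : f x.1 = 0 := x.2
          rw [hD]; simp [hx])
    let Y : LinearMap.ker D →ₗ[A] M :=
      (LinearMap.snd A (Fin k → A) M) ∘ₗ (LinearMap.ker D).subtype
    refine FPn_ext I Y ?_ ?_ ?_ hk h
    · intro x y hxy
      exact Subtype.ext (congrArg (fun z => z.1.1) hxy)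
    · intro y
      obtain ⟨x, hx⟩ := hf (q y)
      exact ⟨⟨(x, y), (hD _).2 hx⟩, rfl⟩
    · ext x
      constructor
      · rintro ⟨y, rfl⟩
        rfl
      · intro hx
        have h2 : x.1.2 = 0 := hx
        have h1 := (hD _).1 x.2
        rw [h2, map_zero] at h1
        exact ⟨⟨x.1.1, h1⟩, Subtype.ext (Prod.ext rfl h2.symm)⟩
  let r : LinearMap.ker D →ₗ[A] LinearMap.ker q :=
    (((-s).coprod LinearMap.id) ∘ₗ (LinearMap.ker D).subtype).codRestrict _
      (fun x => by
        have := (hD _).1 x.2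
        rw [LinearMap.mem_ker]; simp [hs', this])
  have hr : ∀ x, (r x).1 = -s x.1.1 + x.1.2 := fun x => by simp [r]
  refine FPn_quot r ?_ ?_ hX
  · intro y
    have hy : q y.1 = 0 := y.2
    exact ⟨⟨(0, y.1), by rw [hD]; simp [hy]⟩, Subtype.ext (by rw [hr]; simp)⟩
  · let J : (Fin k → A) →ₗ[A] LinearMap.ker r :=
      ((LinearMap.prod LinearMap.id s).codRestrict (LinearMap.ker D)
        (fun x => by rw [hD]; simp [hs'])).codRestrict _
        (fun x => by
          rw [LinearMap.mem_ker]; apply Subtype.ext; rw [hr]; simp)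
    refine FPn_equiv (LinearEquiv.ofBijective J ⟨?_, ?_⟩) (FPn_free k)
    · intro x y hxy
      exact congrArg (fun z => z.1.1.1) hxy
    · intro y
      have hy : (r y.1).1 = 0 := congrArg Subtype.val (show r y.1 = 0 from y.2)
      rw [hr] at hy
      refine ⟨y.1.1.1, Subtype.ext (Subtype.ext (Prod.ext rfl ?_))⟩
      exact neg_add_eq_zero.1 hy

theorem FPn_prod (h : FPn A n M) (h' : FPn A n M') : FPn A n (M × M') := by
  refine FPn_ext (LinearMap.inl A M M') (LinearMap.snd A M M') LinearMap.inl_injective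
    LinearMap.snd_surjective ?_ h h'
  exact LinearMap.range_inl ..

theorem FPn_pi (h : FPn A n M) (k : ℕ) : FPn A n (Fin k → M) := by
  induction k with
  | zero => exact FPn_subsingleton
  | succ k ih => exact FPn_equiv (Fin.consLinearEquiv A (fun _ => M)) (FPn_prod h ih)

theorem proj_ker_aux {k : ℕ} [Module.Projective A M] (f : (Fin k → A) →ₗ[A] M)
    (hf : Function.Surjective f) :
    Module.Finite A (LinearMap.ker f) ∧ Module.Projective A (LinearMap.ker f) := by
  obtain ⟨s, hs⟩ := Module.projective_lifting_property f LinearMap.id hf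
  have hs' : ∀ x, f (s x) = x := fun x => LinearMap.congr_fun hs x
  let r : (Fin k → A) →ₗ[A] LinearMap.ker f :=
    (LinearMap.id - s ∘ₗ f).codRestrict _ (fun x => by
      rw [LinearMap.mem_ker]; simp [hs'])
  have hr : r ∘ₗ (LinearMap.ker f).subtype = LinearMap.id := by
    ext1 x
    have hx : f x.1 = 0 := x.2
    apply Subtype.ext
    simp [r, hx]
  refine ⟨Module.Finite.of_surjective r fun x => ⟨x.1, LinearMap.congr_fun hr x⟩, ?_⟩
  exact Module.Projective.of_split _ r hr

theorem FPn_projective_base {A : Type u} [Ring A] (n : ℕ) :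
    ∀ (P : Type u) [AddCommGroup P] [Module A P] [Module.Finite A P] [Module.Projective A P],
      FPn A n P := by
  induction n with
  | zero => intro P _ _ h _; exact h
  | succ n ih =>
    intro P _ _ _ _
    obtain ⟨k, f, hf⟩ := Module.Finite.exists_fin' A P
    obtain ⟨h1, h2⟩ := proj_ker_aux f hf
    exact FPn_succ.2 ⟨k, f, hf, ih _⟩

theorem FPn_projective [Module.Finite A M] [Module.Projective A M] : FPn A n M := by
  cases n with
  | zero => exact FPn_zero.2 inferInstance
  | succ n =>
    obtain ⟨k, f, hf⟩ := Module.Finite.exists_fin' A M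
    obtain ⟨h1, h2⟩ := proj_ker_aux f hf
    exact FPn_succ.2 ⟨k, f, hf, FPn_projective_base n _⟩

end

/-- From a partial projective resolution to `FPn`. -/
theorem FPn_of_resolution_base {A : Type u} [Ring A] (n : ℕ) :
    ∀ (P : ℕ → Type w) [∀ i, AddCommGroup (P i)] [∀ i, Module A (P i)]
      (M : Type w) [AddCommGroup M] [Module A M]
      (d : ∀ i, P (i + 1) →ₗ[A] P i) (ε : P 0 →ₗ[A] M)
      (_ : ∀ i ≤ n, Module.Finite A (P i)) (_ : ∀ i ≤ n, Module.Projective A (P i))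
      (_ : Function.Surjective ε) (_ : 0 < n → LinearMap.range (d 0) = LinearMap.ker ε)
      (_ : ∀ i, i + 2 ≤ n → LinearMap.range (d (i + 1)) = LinearMap.ker (d i)), FPn A n M := by
  induction n with
  | zero =>
    intro P _ _ M _ _ d ε hfin _ hs _ _
    have := hfin 0 le_rfl
    exact Module.Finite.of_surjective ε hs
  | succ n ih =>
    intro P _ _ M _ _ d ε hfin hproj hs h0 hex
    have := hfin 0 (Nat.zero_le _)
    have := hproj 0 (Nat.zero_le _)
    refine FPn_quot_succ ε hs ?_ FPn_projective
    have h0' := h0 (Nat.succ_pos _)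
    have hmem : ∀ x, d 0 x ∈ LinearMap.ker ε := fun x => h0' ▸ LinearMap.mem_range_self _ x
    refine ih (fun i => P (i + 1)) (LinearMap.ker ε) (fun i => d (i + 1))
      ((d 0).codRestrict _ hmem) (fun i hi => hfin _ (by omega))
      (fun i hi => hproj _ (by omega)) ?_ ?_ (fun i hi => hex (i + 1) (by omega))
    · rintro ⟨y, hy⟩
      rw [← h0'] at hy
      obtain ⟨x, rfl⟩ := hy
      exact ⟨x, rfl⟩
    · intro hn
      rw [LinearMap.ker_codRestrict]
      exact hex 0 (by omega)

theorem FPn_of_resolution {A : Type u} [Ring A] (n : ℕ)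
    (P : ℕ → Type w) [∀ i, AddCommGroup (P i)] [∀ i, Module A (P i)]
    (M : Type v) [AddCommGroup M] [Module A M]
    (d : ∀ i, P (i + 1) →ₗ[A] P i) (ε : P 0 →ₗ[A] M)
    (hfin : ∀ i ≤ n, Module.Finite A (P i)) (hproj : ∀ i ≤ n, Module.Projective A (P i))
    (hs : Function.Surjective ε) (h0 : 0 < n → LinearMap.range (d 0) = LinearMap.ker ε)
    (hex : ∀ i, i + 2 ≤ n → LinearMap.range (d (i + 1)) = LinearMap.ker (d i)) : FPn A n M := by
  refine FPn_equiv ((LinearMap.quotKerEquivOfSurjective ε hs)) ?_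
  refine FPn_of_resolution_base n P _ d (LinearMap.ker ε).mkQ hfin hproj
    (Submodule.mkQ_surjective _) ?_ hex
  rw [Submodule.ker_mkQ]; exact h0

/-- From `FPsub` to a sequence of free modules. -/
theorem FPsub_resolution {A : Type u} [Ring A] (n : ℕ) {k : ℕ} (S : Submodule A (Fin k → A))
    (h : FPsub A n k S) :
    ∃ (l : ℕ → ℕ) (d : ∀ i, (Fin (l (i + 1)) → A) →ₗ[A] (Fin (l i) → A))
      (ε : (Fin (l 0) → A) →ₗ[A] (Fin k → A)), LinearMap.range ε = S ∧
      (0 < n → LinearMap.range (d 0) = LinearMap.ker ε) ∧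
      ∀ i, i + 2 ≤ n → LinearMap.range (d (i + 1)) = LinearMap.ker (d i) := by
  induction n generalizing k with
  | zero =>
    have : Module.Finite A S := Module.Finite.iff_fg.2 h
    obtain ⟨l, f, hf⟩ := Module.Finite.exists_fin' A S
    refine ⟨fun _ => l, fun _ => 0, S.subtype ∘ₗ f, ?_, by simp, by simp⟩
    rw [LinearMap.range_comp, LinearMap.range_eq_top.2 hf]; simp
  | succ n ih =>
    obtain ⟨l₀, f, hf, h⟩ := h
    obtain ⟨l, d, ε, h1, h2, h3⟩ := ih _ h
    refine ⟨fun i => Nat.casesOn i l₀ l, fun i => Nat.casesOn i ε d, f, hf, fun _ => h1, ?_⟩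
    intro i hi
    cases i with
    | zero => exact h2 (by omega)
    | succ i => exact h3 i (by omega)

theorem FPn_resolution {A : Type u} [Ring A] (n : ℕ) {M : Type w} [AddCommGroup M] [Module A M]
    (h : FPn A n M) :
    ∃ (l : ℕ → ℕ) (d : ∀ i, (Fin (l (i + 1)) → A) →ₗ[A] (Fin (l i) → A))
      (ε : (Fin (l 0) → A) →ₗ[A] M), Function.Surjective ε ∧
      (0 < n → LinearMap.range (d 0) = LinearMap.ker ε) ∧
      ∀ i, i + 2 ≤ n → LinearMap.range (d (i + 1)) = LinearMap.ker (d i) := by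
  cases n with
  | zero =>
    have := FPn_finite h
    obtain ⟨l, f, hf⟩ := Module.Finite.exists_fin' A M
    exact ⟨fun _ => l, fun _ => 0, f, hf, by simp, by simp⟩
  | succ n =>
    obtain ⟨l₀, f, hf, h⟩ := h
    obtain ⟨l, d, ε, h1, h2, h3⟩ := FPsub_resolution n _ h
    refine ⟨fun i => Nat.casesOn i l₀ l, fun i => Nat.casesOn i ε d, f, hf, fun _ => h1, ?_⟩
    intro i hi
    cases i with
    | zero => exact h2 (by omega)
    | succ i => exact h3 i (by omega)

theorem isTypeFP_iff (R : Type u) [Ring R] (G : Type v) [Group G] (n : ℕ) :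
    Group.IsTypeFP R G n ↔ FPn (MonoidAlgebra R G) n R := by
  constructor
  · rintro ⟨W⟩
    let _ := W.addCommGroup
    let _ := W.module
    exact FPn_of_resolution n W.P R W.d W.ε W.finite W.projective W.surjective W.exact_zero W.exact
  · intro h
    obtain ⟨l, d, ε, h1, h2, h3⟩ := FPn_resolution n h
    exact ⟨{ P := fun i => Fin (l i) → MonoidAlgebra R G
             module := fun i => Pi.Function.module _ _ _
             d := d, ε := ε
             finite := fun i _ => Module.Finite.pi
             projective := fun i _ => Module.Projective.of_free
             surjective := h1, exact_zero := h2, exact := h3 }⟩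

section ChangeRings

set_option linter.unusedSectionVars false
variable {A : Type u} [Ring A] {B : Type v} [Ring B] [Module A B] [IsScalarTower A B B]

theorem up_zero (hB : FPn A 0 B)
    {M : Type w} [AddCommGroup M] [Module A M] [Module B M] [IsScalarTower A B M]
    (h : FPn B 0 M) : FPn A 0 M := by
  have := FPn_finite h
  have hB := FPn_finite (FPn_zero.2 hB)
  obtain ⟨k, f, hf⟩ := Module.Finite.exists_fin' B M
  exact Module.Finite.of_surjective (f.restrictScalars A) hf

theorem up_step (n : ℕ) (hB : FPn A (n + 1) B)
    (ih : ∀ (L : Type v) [AddCommGroup L] [Module A L] [Module B L] [IsScalarTower A B L],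
      FPn B n L → FPn A n L)
    {M : Type w} [AddCommGroup M] [Module A M] [Module B M] [IsScalarTower A B M]
    (h : FPn B (n + 1) M) : FPn A (n + 1) M := by
  obtain ⟨k, f, hf, hk⟩ := FPn_succ.1 h
  refine FPn_quot_succ (f.restrictScalars A) hf ?_ (FPn_pi hB k)
  exact ih ((LinearMap.ker f).restrictScalars A) hk

theorem up_base (n : ℕ) (hB : FPn A n B) :
    ∀ (L : Type v) [AddCommGroup L] [Module A L] [Module B L] [IsScalarTower A B L],
      FPn B n L → FPn A n L := by
  induction n with
  | zero => intro L _ _ _ _ h; exact up_zero hB h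
  | succ n ih => intro L _ _ _ _ h; exact up_step n hB (ih (FPn_of_succ hB)) h

theorem FPn_up (n : ℕ) (hB : FPn A n B)
    {M : Type w} [AddCommGroup M] [Module A M] [Module B M] [IsScalarTower A B M]
    (h : FPn B n M) : FPn A n M := by
  cases n with
  | zero => exact up_zero hB h
  | succ n => exact up_step n hB (up_base n (FPn_of_succ hB)) h

theorem down_zero
    {M : Type w} [AddCommGroup M] [Module A M] [Module B M] [IsScalarTower A B M]
    (h : FPn A 0 M) : FPn B 0 M := by
  have := FPn_finite h
  exact Module.Finite.of_restrictScalars_finite A B M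

theorem down_step (n : ℕ) (hB : FPn A n B)
    (ih : ∀ (L : Type v) [AddCommGroup L] [Module A L] [Module B L] [IsScalarTower A B L],
      FPn A n L → FPn B n L)
    {M : Type w} [AddCommGroup M] [Module A M] [Module B M] [IsScalarTower A B M]
    (h : FPn A (n + 1) M) : FPn B (n + 1) M := by
  have := FPn_finite (down_zero (B := B) (FPn_finite h))
  obtain ⟨k, f, hf⟩ := Module.Finite.exists_fin' B M
  refine FPn_succ.2 ⟨k, f, hf, ?_⟩
  have := FPn_ker (f.restrictScalars A) hf (FPn_pi hB k) h
  exact ih ((LinearMap.ker f).restrictScalars A) this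

theorem down_base (n : ℕ) (hB : FPn A (n - 1) B) :
    ∀ (L : Type v) [AddCommGroup L] [Module A L] [Module B L] [IsScalarTower A B L],
      FPn A n L → FPn B n L := by
  induction n with
  | zero => intro L _ _ _ _ h; exact down_zero h
  | succ n ih =>
    intro L _ _ _ _ h
    exact down_step n hB (ih (FPn_mono (by omega) hB)) h

theorem FPn_down (n : ℕ) (hB : FPn A (n - 1) B)
    {M : Type w} [AddCommGroup M] [Module A M] [Module B M] [IsScalarTower A B M]
    (h : FPn A n M) : FPn B n M := by
  cases n with
  | zero => exact down_zero h
  | succ n => exact down_step n hB (down_base n (FPn_mono (by omega) hB)) h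

end ChangeRings

section Induction

variable {C : Type u} [Ring C] {A : Type v} [Ring A] (j : C →+* A) {T : Type w}
  (τ : T → A) (π : T → A →+ C)

theorem ind_zero {M : Type w₁} [AddCommGroup M] [Module C M] {M' : Type w₂} [AddCommGroup M']
    [Module A M'] (ι : M →+ M') (hι : ∀ c m, ι (c • m) = j c • ι m)
    (hspan : ∀ S : Submodule A M', (∀ m, ι m ∈ S) → S = ⊤)
    (h : FPn C 0 M) : FPn A 0 M' := by
  classical
  obtain ⟨s, hs⟩ := (FPn_finite h).1
  refine ⟨⟨s.image ι, hspan _ fun m => ?_⟩⟩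
  have hm : m ∈ Submodule.span C (s : Set M) := hs ▸ Submodule.mem_top
  induction hm using Submodule.span_induction with
  | mem x hx => exact Submodule.subset_span (by simpa using ⟨x, hx, rfl⟩)
  | zero => rw [map_zero]; exact Submodule.zero_mem _
  | add x y _ _ hx hy => rw [map_add]; exact Submodule.add_mem _ hx hy
  | smul c x _ hx => rw [hι]; exact Submodule.smul_mem _ _ hx

theorem ind_step (n : ℕ) (hπ : ∀ t a c, π t (a * j c) = π t a * c)
    (hdual : ∀ (k : ℕ) (a : Fin k → A), ∃ s : Finset T,
      ∀ i, a i = ∑ t ∈ s, τ t * j (π t (a i)))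
    (ih : ∀ (M : Type u) [AddCommGroup M] [Module C M] (M' : Type v) [AddCommGroup M']
      [Module A M'] (ι : M →+ M') (_ : ∀ c m, ι (c • m) = j c • ι m)
      (_ : ∀ S : Submodule A M', (∀ m, ι m ∈ S) → S = ⊤)
      (Ω : T → M' →+ M) (_ : ∀ t a m, Ω t (a • ι m) = π t a • m),
      FPn C n M → FPn A n M')
    {M : Type w₁} [AddCommGroup M] [Module C M] {M' : Type w₂} [AddCommGroup M']
    [Module A M'] (ι : M →+ M') (hι : ∀ c m, ι (c • m) = j c • ι m)
    (hspan : ∀ S : Submodule A M', (∀ m, ι m ∈ S) → S = ⊤)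
    (Ω : T → M' →+ M) (hΩ : ∀ t a m, Ω t (a • ι m) = π t a • m)
    (h : FPn C (n + 1) M) : FPn A (n + 1) M' := by
  obtain ⟨k, f, hf, hk⟩ := FPn_succ.1 h
  let b : Fin k → M := fun i => f (Pi.single i 1)
  have hfb : ∀ c : Fin k → C, f c = ∑ i, c i • b i := fun c => by
    conv_lhs => rw [pi_eq_sum_univ' c]
    simp only [map_sum, map_smul, b]
  let F : (Fin k → A) →ₗ[A] M' := Fintype.linearCombination A (fun i => ι (b i))
  have hF : ∀ a, F a = ∑ i, a i • ι (b i) := fun a => Fintype.linearCombination_apply ..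
  have hFι : ∀ c : Fin k → C, F (fun i => j (c i)) = ι (f c) := fun c => by
    rw [hF, hfb, map_sum]; simp only [hι]
  have hFΩ : ∀ t a, Ω t (F a) = f (fun i => π t (a i)) := fun t a => by
    rw [hF, hfb, map_sum]; simp only [hΩ]
  refine FPn_succ.2 ⟨k, F, ?_, ?_⟩
  · rw [← LinearMap.range_eq_top]
    refine hspan _ fun m => ?_
    obtain ⟨c, rfl⟩ := hf m
    exact ⟨_, hFι c⟩
  · let ι' : LinearMap.ker f →+ LinearMap.ker F :=
      { toFun := fun c => ⟨fun i => j (c.1 i), by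
          have hc : f c.1 = 0 := c.2
          rw [LinearMap.mem_ker, hFι, hc, map_zero]⟩
        map_zero' := by ext i; simp
        map_add' := fun x y => by ext i; simp }
    let Ω' : T → LinearMap.ker F →+ LinearMap.ker f := fun t =>
      { toFun := fun a => ⟨fun i => π t (a.1 i), by
          have ha : F a.1 = 0 := a.2
          rw [LinearMap.mem_ker, ← hFΩ, ha, map_zero]⟩
        map_zero' := by ext i; simp
        map_add' := fun x y => by ext i; simp }
    refine ih (LinearMap.ker f) (LinearMap.ker F) ι' ?_ ?_ Ω' ?_ hk
    · intro c m; ext i; simp [ι']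
    · intro S hS
      rw [eq_top_iff]
      rintro a -
      obtain ⟨s, hs⟩ := hdual k a.1
      have : a = ∑ t ∈ s, τ t • ι' (Ω' t a) := by
        ext i
        rw [hs i]
        simp [ι', Ω']
      rw [this]
      exact Submodule.sum_mem _ fun t _ => S.smul_mem _ (hS _)
    · intro t a m; ext i; simp [ι', Ω', hπ]

theorem ind_base (n : ℕ) (hπ : ∀ t a c, π t (a * j c) = π t a * c)
    (hdual : ∀ (k : ℕ) (a : Fin k → A), ∃ s : Finset T,
      ∀ i, a i = ∑ t ∈ s, τ t * j (π t (a i))) :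
    ∀ (M : Type u) [AddCommGroup M] [Module C M] (M' : Type v) [AddCommGroup M']
      [Module A M'] (ι : M →+ M') (_ : ∀ c m, ι (c • m) = j c • ι m)
      (_ : ∀ S : Submodule A M', (∀ m, ι m ∈ S) → S = ⊤)
      (Ω : T → M' →+ M) (_ : ∀ t a m, Ω t (a • ι m) = π t a • m),
      FPn C n M → FPn A n M' := by
  induction n with
  | zero => intro M _ _ M' _ _ ι hι hspan Ω hΩ h; exact ind_zero j ι hι hspan h
  | succ n ih =>
    intro M _ _ M' _ _ ι hι hspan Ω hΩ h
    exact ind_step j τ π n hπ hdual ih ι hι hspan Ω hΩ h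

theorem FPn_ind (n : ℕ) (hπ : ∀ t a c, π t (a * j c) = π t a * c)
    (hdual : ∀ (k : ℕ) (a : Fin k → A), ∃ s : Finset T,
      ∀ i, a i = ∑ t ∈ s, τ t * j (π t (a i)))
    {M : Type w₁} [AddCommGroup M] [Module C M] {M' : Type w₂} [AddCommGroup M']
    [Module A M'] (ι : M →+ M') (hι : ∀ c m, ι (c • m) = j c • ι m)
    (hspan : ∀ S : Submodule A M', (∀ m, ι m ∈ S) → S = ⊤)
    (Ω : T → M' →+ M) (hΩ : ∀ t a m, Ω t (a • ι m) = π t a • m)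
    (h : FPn C n M) : FPn A n M' := by
  cases n with
  | zero => exact ind_zero j ι hι hspan h
  | succ n => exact ind_step j τ π n hπ hdual (ind_base j τ π n hπ hdual) ι hι hspan Ω hΩ h

end Induction

section Groups

open MonoidAlgebra

theorem augmentation_single (R : Type u) [Ring R] (G : Type v) [Group G] (g : G) (r : R) :
    augmentation R G (single g r) = r := by
  simp [augmentation]

theorem triv_smul (R : Type u) [Ring R] (G : Type v) [Group G] (a : MonoidAlgebra R G) (r : R) :
    a • r = augmentation R G a * r := rfl

theorem augmentation_mapDomain (R : Type u) [Ring R] {G : Type v} [Group G] {K : Type w} [Group K]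
    (q : G →* K) (a : MonoidAlgebra R G) :
    augmentation R K (mapDomainRingHom R q a) = augmentation R G a := by
  induction a using MonoidAlgebra.induction_linear with
  | zero => simp
  | add x y hx hy => rw [map_add, map_add, map_add, hx, hy]
  | single g r => simp [augmentation_single]

/-- The group ring of the quotient is of type `FP_n` over the group ring. -/
theorem FPn_quotient_groupRing (R : Type u) [Ring R] {N : Type w₁} {H : Type w₂} {K : Type w₃}
    [Group N] [Group H] [Group K] (i : N →* H) (q : H →* K) (hi : Function.Injective i)
    (hq : Function.Surjective q) (hiq : i.range = q.ker) (n : ℕ)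
    (h : FPn (MonoidAlgebra R N) n R) :
    @FPn (MonoidAlgebra R H) _ n (MonoidAlgebra R K) _
      (Module.compHom _ (mapDomainRingHom R q)) := by
  classical
  obtain ⟨σ, hσ⟩ := hq.hasRightInverse
  have hqi : ∀ x, q (i x) = 1 := fun x => by
    have : i x ∈ q.ker := hiq ▸ ⟨x, rfl⟩
    exact this
  have hinj : ∀ k, Function.Injective (fun x : N => σ k * i x) := fun k =>
    (mul_right_injective _).comp hi
  let π : K → MonoidAlgebra R H →+ MonoidAlgebra R N := fun k =>
    comapDomainAddMonoidHom (fun x : N => σ k * i x) (hinj k)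
  have hπc : ∀ k a x, (π k a).coeff x = a.coeff (σ k * i x) := fun k a x => by
    simp [π]
  have hcoset : ∀ k g, q g = k → ∃ x, g = σ k * i x := fun k g hg => by
    have : (σ k)⁻¹ * g ∈ i.range := by
      rw [hiq, MonoidHom.mem_ker, map_mul, map_inv, hσ, hg, inv_mul_cancel]
    obtain ⟨x, hx⟩ := this
    exact ⟨x, by rw [hx]; group⟩
  have hπs : ∀ k x r, π k (single (σ k * i x) r) = single x r := fun k x r =>
    comapDomain_single_map (fun x : N => σ k * i x) (hinj k) x r
  have hπs' : ∀ k g r, q g ≠ k → π k (single g r) = 0 := fun k g r hg => by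
    refine comapDomain_single_of_not_mem_range (f := fun x : N => σ k * i x) ?_ (hinj k)
    rintro ⟨x, rfl⟩
    exact hg (by simp [hσ k, hqi])
  have hπ : ∀ k a c, π k (a * mapDomainRingHom R i c) = π k a * c := by
    intro k a c
    induction c using MonoidAlgebra.induction_linear with
    | zero => simp
    | add x y hx hy => rw [map_add, mul_add, map_add, hx, hy, mul_add]
    | single g r =>
      ext x
      rw [hπc]
      simp [hπc, mul_assoc]
  have hsum : ∀ (a : MonoidAlgebra R H) (s : Finset K), (∀ g, a.coeff g ≠ 0 → q g ∈ s) →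
      a = ∑ k ∈ s, single (σ k) 1 * mapDomainRingHom R i (π k a) := by
    intro a s hs
    ext g
    have hterm : ∀ k, (single (σ k) 1 * mapDomainRingHom R i (π k a)).coeff g =
        if q g = k then a.coeff g else 0 := by
      intro k
      have hmd : (mapDomainRingHom R i (π k a)).coeff = Finsupp.mapDomain i (π k a).coeff := by
        simp
      rw [coeff_single_mul_apply, one_mul, hmd]
      split_ifs with hg
      · obtain ⟨x, rfl⟩ := hcoset k g hg
        rw [inv_mul_cancel_left, Finsupp.mapDomain_apply hi, hπc]
      · refine Finsupp.mapDomain_of_notMem_range _ _ ?_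
        rintro ⟨x, hx⟩
        apply hg
        have hx2 := congrArg q hx
        rw [hqi, map_mul, map_inv, hσ] at hx2
        exact (inv_mul_eq_one.1 hx2.symm).symm
    rw [coeff_sum, Finsupp.finsetSum_apply, Finset.sum_congr rfl fun k _ => hterm k,
      Finset.sum_ite_eq]
    split_ifs with hg
    · rfl
    · by_contra hne
      exact hg (hs g hne)
  have haug : ∀ k a, (mapDomainRingHom R q a).coeff k = augmentation R N (π k a) := by
    intro k a
    induction a using MonoidAlgebra.induction_linear with
    | zero => simp
    | add x y hx hy => rw [map_add, coeff_add, Finsupp.add_apply, hx, hy, map_add, map_add]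
    | single g r =>
      by_cases hg : q g = k
      · obtain ⟨x, rfl⟩ := hcoset k g hg
        rw [hπs, augmentation_single]
        simp [hσ k, hqi]
      · rw [hπs' _ _ _ hg]
        simp [hg]
  refine @FPn_ind _ _ _ _ (mapDomainRingHom R i) _ (fun k => single (σ k) (1 : R)) π n hπ ?_
    R _ _ (MonoidAlgebra R K) _ (Module.compHom _ (mapDomainRingHom R q))
    (singleAddHom (1 : K)) ?_ ?_
    (fun k => (Finsupp.applyAddHom k).comp (coeffAddEquiv (R := R) (M := K)).toAddMonoidHom) ?_ h
  · intro k a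
    refine ⟨Finset.univ.biUnion fun l => (a l).coeff.support.image q, fun l => hsum _ _ ?_⟩
    intro g hg
    simp only [Finset.mem_biUnion, Finset.mem_image]
    exact ⟨l, Finset.mem_univ _, g, by simpa using hg, rfl⟩
  · intro c r
    change single 1 (augmentation R N c * r) =
      mapDomainRingHom R q (mapDomainRingHom R i c) * single 1 r
    induction c using MonoidAlgebra.induction_linear with
    | zero => simp
    | add x y hx hy => simp only [map_add, add_mul, single_add, hx, hy]
    | single g s => simp [augmentation_single, hqi]
  · intro S hS
    rw [eq_top_iff]
    rintro b -
    induction b using MonoidAlgebra.induction_linear with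
    | zero => exact Submodule.zero_mem _
    | add x y hx hy => exact Submodule.add_mem _ hx hy
    | single k r =>
      have := S.smul_mem (single (σ k) (1 : R)) (hS r)
      have h2 : mapDomainRingHom R q (single (σ k) (1 : R)) * single 1 r = single k r := by
        simp [hσ k]
      rw [← h2]
      exact this
  · intro k a r
    change (mapDomainRingHom R q a * single 1 r).coeff k = augmentation R N (π k a) * r
    rw [coeff_mul_single_apply, ← haug]
    simp

theorem isTypeFP_up (R : Type u) [Ring R] {N : Type w₁} {H : Type w₂} {K : Type w₃}
    [Group N] [Group H] [Group K] (i : N →* H) (q : H →* K) (hi : Function.Injective i)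
    (hq : Function.Surjective q) (hiq : i.range = q.ker) (n : ℕ)
    (hN : Group.IsTypeFP R N n) (hK : Group.IsTypeFP R K n) : Group.IsTypeFP R H n := by
  rw [isTypeFP_iff] at hN hK ⊢
  have hB := FPn_quotient_groupRing R i q hi hq hiq n hN
  refine @FPn_up _ _ _ _ (Module.compHom _ (mapDomainRingHom R q)) ?_ n hB R _ _ _ ?_ hK
  · exact @IsScalarTower.mk _ _ _ (_) (_) (_) fun a b c => mul_assoc _ _ _
  · refine @IsScalarTower.mk _ _ _ (_) (_) (_) fun a b c => ?_
    change augmentation R K (mapDomainRingHom R q a * b) * c =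
      augmentation R H a * (augmentation R K b * c)
    rw [map_mul, augmentation_mapDomain, mul_assoc]

theorem isTypeFP_down (R : Type u) [Ring R] {N : Type w₁} {H : Type w₂} {K : Type w₃}
    [Group N] [Group H] [Group K] (i : N →* H) (q : H →* K) (hi : Function.Injective i)
    (hq : Function.Surjective q) (hiq : i.range = q.ker) (n : ℕ)
    (hN : Group.IsTypeFP R N (n - 1)) (hH : Group.IsTypeFP R H n) : Group.IsTypeFP R K n := by
  rw [isTypeFP_iff] at hN hH ⊢
  have hB := FPn_quotient_groupRing R i q hi hq hiq _ hN
  refine @FPn_down _ _ _ _ (Module.compHom _ (mapDomainRingHom R q)) ?_ n hB R _ _ _ ?_ hH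
  · exact @IsScalarTower.mk _ _ _ (_) (_) (_) fun a b c => mul_assoc _ _ _
  · refine @IsScalarTower.mk _ _ _ (_) (_) (_) fun a b c => ?_
    change augmentation R K (mapDomainRingHom R q a * b) * c =
      augmentation R H a * (augmentation R K b * c)
    rw [map_mul, augmentation_mapDomain, mul_assoc]

theorem isTypeFP_mono (R : Type u) [Ring R] {G : Type v} [Group G] {n m : ℕ} (h : n ≤ m)
    (hG : Group.IsTypeFP R G m) : Group.IsTypeFP R G n := by
  rw [isTypeFP_iff] at hG ⊢
  exact FPn_mono h hG

end Groups

end HomAlg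

/-- Homological extension inheritance, part (ii): let `R` be a nontrivial ring,
`n < m`, and let `p : G → Q` be a surjective group homomorphism with kernel `N`.
If every subgroup of `G` of type `FP_n(R)` is of type `FP_m(R)` and `N` is of type
`FP_{m-1}(R)`, then every subgroup of `Q` of type `FP_n(R)` is of type `FP_m(R)`. -/
theorem fp_coherent_of_quotient_of_group_extension {R : Type*} [Ring R] [Nontrivial R]
    {G Q : Type*} [Group G] [Group Q] (n m : ℕ) (hnm : n < m)
    (p : G →* Q) (hp : Function.Surjective p) (N : Subgroup G) (hN : N = p.ker)
    (hG : ∀ H : Subgroup G, Group.IsTypeFP R H n → Group.IsTypeFP R H m)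
    (hNfp : Group.IsTypeFP R N (m - 1)) :
    ∀ K : Subgroup Q, Group.IsTypeFP R K n → Group.IsTypeFP R K m := by
  intro K hK
  subst hN
  let H : Subgroup G := K.comap p
  let i : p.ker →* H := Subgroup.inclusion (fun x hx => by
    have hx' : p x = 1 := hx
    change p x ∈ K
    rw [hx']; exact K.one_mem)
  let q : H →* K := (p.comp H.subtype).codRestrict K (fun x => x.2)
  have hi : Function.Injective i := Subgroup.inclusion_injective _
  have hq : Function.Surjective q := by
    rintro ⟨k, hk⟩
    obtain ⟨g, rfl⟩ := hp k
    exact ⟨⟨g, hk⟩, rfl⟩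
  have hiq : i.range = q.ker := by
    ext x
    constructor
    · rintro ⟨y, rfl⟩
      exact Subtype.ext y.2
    · intro hx
      exact ⟨⟨x.1, congrArg Subtype.val (show q x = 1 from hx)⟩, rfl⟩
  have hH : Group.IsTypeFP R H n :=
    isTypeFP_up R i q hi hq hiq n (isTypeFP_mono R (by omega) hNfp) hK
  exact isTypeFP_down R i q hi hq hiq m hNfp (hG H hH)
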